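/- arXiv:1909.11705 — 3 statements merged into one kernel-verified Lean document; each statement's English description precedes it below -/
import Mathlib

section
/- For every integer d ≥ 0, the ℂ-vector space S_d/(Ī₂)_d has dimension binom(m,d)·binom(n,d); in particular, (Ī₂)_d = S_d whenever d > min(m,n), i.e. the ideal generated by the generalized 2×2 permanents contains every homogeneous polynomial of degree greater than min(m,n). -/
open MvPolynomial

/-- Index set for the generalized 2×2 permanents of a generic `m × n` matrix:
quadruples `((i,i'),(j,j'))` with `i ≤ i'` and `j ≤ j'`. -/
def PermIdx (m n : ℕ) : Type :=
  {w : (Fin m × Fin m) × (Fin n × Fin n) // w.1.1 ≤ w.1.2 ∧ w.2.1 ≤ w.2.2}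

/-- The generalized 2×2 permanent
`p_{(i,i'),(j,j')} = x_{i,j} x_{i',j'} + x_{i,j'} x_{i',j}`. -/
noncomputable def perm {m n : ℕ} (w : PermIdx m n) : MvPolynomial (Fin m × Fin n) ℂ :=
  X (w.1.1.1, w.1.2.1) * X (w.1.1.2, w.1.2.2) + X (w.1.1.1, w.1.2.2) * X (w.1.1.2, w.1.2.1)

/-- The ideal `Ī₂ ⊆ S` generated by all generalized 2×2 permanents. -/
noncomputable def I2bar (m n : ℕ) : Ideal (MvPolynomial (Fin m × Fin n) ℂ) :=
  Ideal.span (Set.range (perm (m := m) (n := n)))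

namespace PermProof

variable {m n d : ℕ}

lemma rel_mem (i i' : Fin m) (j j' : Fin n) :
    (X (i, j) * X (i', j') + X (i, j') * X (i', j) : MvPolynomial (Fin m × Fin n) ℂ)
      ∈ I2bar m n := by
  have key : ∀ (i i' : Fin m) (j j' : Fin n), i ≤ i' → j ≤ j' →
      (X (i, j) * X (i', j') + X (i, j') * X (i', j) : MvPolynomial (Fin m × Fin n) ℂ)
      ∈ I2bar m n := fun i i' j j' h h' =>
    Ideal.subset_span ⟨⟨((i, i'), (j, j')), h, h'⟩, rfl⟩
  rcases le_total i i' with h | h <;> rcases le_total j j' with h' | h'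
  · exact key _ _ _ _ h h'
  · have := key _ _ _ _ h h'
    rwa [add_comm] at this
  · have := key _ _ _ _ h h'
    convert this using 1; ring
  · have := key _ _ _ _ h h'
    convert this using 1; ring

/-- exponent of the monomial of a permutation -/
noncomputable def expo (α : Fin d → Fin m) (β : Fin d → Fin n) : Fin m × Fin n →₀ ℕ :=
  ∑ k, Finsupp.single (α k, β k) 1

lemma prod_eq (α : Fin d → Fin m) (β : Fin d → Fin n) :
    (∏ k, X (α k, β k) : MvPolynomial (Fin m × Fin n) ℂ) = monomial (expo α β) 1 := by
  rw [expo, monomial_sum_one]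
  rfl

lemma exists_expo (s : Fin m × Fin n →₀ ℕ) (hs : s.degree = d) :
    ∃ (α : Fin d → Fin m) (β : Fin d → Fin n), s = expo α β := by
  classical
  induction d generalizing s with
  | zero =>
    refine ⟨Fin.elim0, Fin.elim0, ?_⟩
    simpa [expo] using (Finsupp.degree_eq_zero_iff s).1 hs
  | succ d ih =>
    have hne : s ≠ 0 := by
      rintro rfl; simp at hs
    obtain ⟨p, hp⟩ := Finsupp.ne_iff.1 hne
    have hle : Finsupp.single p 1 ≤ s := by
      rw [Finsupp.single_le_iff]
      exact Nat.one_le_iff_ne_zero.2 hp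
    obtain ⟨t, rfl⟩ := exists_add_of_le hle
    have ht : t.degree = d := by
      rw [map_add, Finsupp.degree_single] at hs; omega
    obtain ⟨α, β, rfl⟩ := ih t ht
    refine ⟨Fin.cons p.1 α, Fin.cons p.2 β, ?_⟩
    simp [expo, Fin.sum_univ_succ]

lemma expo_fst (α : Fin d → Fin m) (β : Fin d → Fin n) (hα : Function.Injective α) (i : Fin m) :
    (Finsupp.mapDomain Prod.fst (expo α β)) i ≤ 1 := by
  classical
  have : (Finsupp.mapDomain Prod.fst (expo α β)) i = ∑ k, if α k = i then 1 else 0 := by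
    rw [expo, Finsupp.mapDomain_finsetSum, Finsupp.finsetSum_apply]
    simp [Finsupp.mapDomain_single, Finsupp.single_apply]
  rw [this, ← Finset.card_filter, Finset.card_le_one]
  intro a ha b hb
  simp at ha hb
  exact hα (ha.trans hb.symm)

lemma expo_snd (α : Fin d → Fin m) (β : Fin d → Fin n) (hβ : Function.Injective β) (i : Fin n) :
    (Finsupp.mapDomain Prod.snd (expo α β)) i ≤ 1 := by
  classical
  have : (Finsupp.mapDomain Prod.snd (expo α β)) i = ∑ k, if β k = i then 1 else 0 := by
    rw [expo, Finsupp.mapDomain_finsetSum, Finsupp.finsetSum_apply]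
    simp [Finsupp.mapDomain_single, Finsupp.single_apply]
  rw [this, ← Finset.card_filter, Finset.card_le_one]
  intro a ha b hb
  simp at ha hb
  exact hβ (ha.trans hb.symm)

lemma expo_apply_ne (α : Fin d → Fin m) (β : Fin d → Fin n) (p : Fin m × Fin n) :
    expo α β p ≠ 0 ↔ ∃ k, (α k, β k) = p := by
  classical
  rw [expo, Finsupp.finsetSum_apply]
  simp [Finsupp.single_apply]

/-- The determinantal functional. -/
noncomputable def Phi (a : Fin d → Fin m) (b : Fin d → Fin n) :
    MvPolynomial (Fin m × Fin n) ℂ →ₗ[ℂ] ℂ :=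
  ∑ σ : Equiv.Perm (Fin d), ((Equiv.Perm.sign σ : ℤ) : ℂ) • lcoeff ℂ (expo a (b ∘ σ))

lemma Phi_monomial (a : Fin d → Fin m) (b : Fin d → Fin n) (s : Fin m × Fin n →₀ ℕ) (r : ℂ) :
    Phi a b (monomial s r) = ∑ σ : Equiv.Perm (Fin d),
      ((Equiv.Perm.sign σ : ℤ) : ℂ) * (if s = expo a (b ∘ σ) then r else 0) := by
  classical
  simp [Phi, coeff_monomial]

lemma expo_swap (a : Fin d → Fin m) (b : Fin d → Fin n) (ha : Function.Injective a)
    (s : Fin m × Fin n →₀ ℕ) (k k' : Fin d) (hk : k ≠ k') (j j' : Fin n)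
    (h : s + (Finsupp.single (a k, j) 1 + Finsupp.single (a k', j') 1) = expo a b) :
    s + (Finsupp.single (a k, j') 1 + Finsupp.single (a k', j) 1) =
      expo a (b ∘ Equiv.swap k k') := by
  classical
  have h1 : b k = j := by
    obtain ⟨l, hl⟩ := (expo_apply_ne a b (a k, j)).1 (by rw [← h]; simp)
    simp only [Prod.mk.injEq] at hl
    rw [← ha hl.1]; exact hl.2
  have h2 : b k' = j' := by
    obtain ⟨l, hl⟩ := (expo_apply_ne a b (a k', j')).1 (by rw [← h]; simp)
    simp only [Prod.mk.injEq] at hl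
    rw [← ha hl.1]; exact hl.2
  have split : ∀ c : Fin d → Fin n, expo a c = (∑ l ∈ (Finset.univ.erase k).erase k',
      Finsupp.single (a l, c l) 1) +
      (Finsupp.single (a k, c k) 1 + Finsupp.single (a k', c k') 1) := by
    intro c
    rw [expo, ← Finset.sum_erase_add _ _ (Finset.mem_univ k),
      ← Finset.sum_erase_add (Finset.univ.erase k) _
        (Finset.mem_erase.2 ⟨hk.symm, Finset.mem_univ k'⟩)]
    abel
  rw [split b, h1, h2] at h
  have h3 := add_right_cancel h
  rw [split, h3]
  simp only [Function.comp, Equiv.swap_apply_left, Equiv.swap_apply_right, h1, h2]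
  congr 1
  refine Finset.sum_congr rfl fun l hl => ?_
  simp only [Finset.mem_erase] at hl
  rw [Equiv.swap_apply_of_ne_of_ne hl.2.1 hl.1]

lemma Phi_rel (a : Fin d → Fin m) (b : Fin d → Fin n) (ha : Function.Injective a)
    (hb : Function.Injective b) (s : Fin m × Fin n →₀ ℕ) (r : ℂ) (i i' : Fin m) (j j' : Fin n) :
    Phi a b (monomial s r * (X (i, j) * X (i', j') + X (i, j') * X (i', j))) = 0 := by
  classical
  have e : ∀ p q : Fin m × Fin n, (monomial s r * (X p * X q) : MvPolynomial (Fin m × Fin n) ℂ)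
      = monomial (s + (Finsupp.single p 1 + Finsupp.single q 1)) r := by
    intro p q
    simp [X, monomial_mul]
  rw [mul_add, map_add, e, e]
  have van : ∀ t, (∀ σ : Equiv.Perm (Fin d), t ≠ expo a (b ∘ σ)) → Phi a b (monomial t r) = 0 := by
    intro t ht
    rw [Phi_monomial]
    exact Finset.sum_eq_zero fun σ _ => by simp [ht σ]
  by_cases hi : i = i'
  · subst hi
    have : ∀ j j' : Fin n, Phi a b (monomial (s + (Finsupp.single (i, j) 1 +
        Finsupp.single (i, j') 1)) r) = 0 := by
      intro j j'
      refine van _ fun σ h => ?_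
      have := expo_fst a (b ∘ σ) ha i
      rw [← h] at this
      simp [Finsupp.mapDomain_add, Finsupp.mapDomain_single] at this
    rw [this, this, add_zero]
  by_cases hj : j = j'
  · subst hj
    have : ∀ i i' : Fin m, Phi a b (monomial (s + (Finsupp.single (i, j) 1 +
        Finsupp.single (i', j) 1)) r) = 0 := by
      intro i i'
      refine van _ fun σ h => ?_
      have := expo_snd a (b ∘ σ) (hb.comp σ.injective) j
      rw [← h] at this
      simp [Finsupp.mapDomain_add, Finsupp.mapDomain_single] at this
    rw [this, add_zero]
  by_cases hk : ∃ k, a k = i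
  swap
  · rw [van, van, add_zero]
    all_goals
      intro σ h
      apply hk
      have h' := DFunLike.congr_fun h
    · obtain ⟨l, hl⟩ := (expo_apply_ne a (b ∘ σ) (i, j')).1 (by rw [← h]; simp)
      exact ⟨l, congrArg Prod.fst hl⟩
    · obtain ⟨l, hl⟩ := (expo_apply_ne a (b ∘ σ) (i, j)).1 (by rw [← h]; simp)
      exact ⟨l, congrArg Prod.fst hl⟩
  by_cases hk' : ∃ k, a k = i'
  swap
  · rw [van, van, add_zero]
    all_goals
      intro σ h
      apply hk'
      have h' := DFunLike.congr_fun h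
    · obtain ⟨l, hl⟩ := (expo_apply_ne a (b ∘ σ) (i', j)).1 (by rw [← h]; simp)
      exact ⟨l, congrArg Prod.fst hl⟩
    · obtain ⟨l, hl⟩ := (expo_apply_ne a (b ∘ σ) (i', j')).1 (by rw [← h]; simp)
      exact ⟨l, congrArg Prod.fst hl⟩
  obtain ⟨k, rfl⟩ := hk
  obtain ⟨k', rfl⟩ := hk'
  have hkk : k ≠ k' := fun h => hi (by rw [h])
  rw [Phi_monomial, Phi_monomial,
    ← Equiv.sum_comp (Equiv.mulRight (Equiv.swap k k')) (fun σ : Equiv.Perm (Fin d) =>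
      ((Equiv.Perm.sign σ : ℤ) : ℂ) * (if s + (Finsupp.single (a k, j') 1 +
        Finsupp.single (a k', j) 1) = expo a (b ∘ σ) then r else 0)),
    ← Finset.sum_add_distrib]
  refine Finset.sum_eq_zero fun σ _ => ?_
  have hiff : (s + (Finsupp.single (a k, j) 1 + Finsupp.single (a k', j') 1) = expo a (b ∘ σ)) ↔
      (s + (Finsupp.single (a k, j') 1 + Finsupp.single (a k', j) 1) =
        expo a (b ∘ (σ * Equiv.swap k k' : Equiv.Perm (Fin d)))) := by
    constructor
    · intro h
      exact expo_swap a (b ∘ σ) ha s k k' hkk j j' h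
    · intro h
      have := expo_swap a _ ha s k k' hkk j' j h
      rw [this]
      congr 1
      funext x
      simp
  have hτ : Equiv.mulRight (Equiv.swap k k') σ = σ * Equiv.swap k k' := rfl
  have hsg : Equiv.Perm.sign (σ * Equiv.swap k k') = - Equiv.Perm.sign σ := by
    rw [Equiv.Perm.sign_mul, Equiv.Perm.sign_swap hkk, mul_neg, mul_one]
  rw [← hτ] at hiff hsg
  generalize Equiv.mulRight (Equiv.swap k k') σ = τ at hiff hsg ⊢
  rw [hsg]
  by_cases hc : s + (Finsupp.single (a k, j) 1 + Finsupp.single (a k', j') 1) = expo a (b ∘ σ)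
  · rw [if_pos hc, if_pos (hiff.1 hc)]
    push_cast
    ring
  · rw [if_neg hc, if_neg (fun h => hc (hiff.2 h))]
    ring

lemma Phi_ideal (a : Fin d → Fin m) (b : Fin d → Fin n) (ha : Function.Injective a)
    (hb : Function.Injective b) (f : MvPolynomial (Fin m × Fin n) ℂ) (hf : f ∈ I2bar m n) :
    Phi a b f = 0 := by
  refine Submodule.span_induction (p := fun f _ => ∀ q, Phi a b (q * f) = 0)
    ?_ ?_ ?_ ?_ hf 1 |> fun h => by simpa using h
  · rintro _ ⟨w, rfl⟩ q
    induction q using MvPolynomial.induction_on' with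
    | monomial s r => exact Phi_rel a b ha hb s r _ _ _ _
    | add p q hp hq => rw [add_mul, map_add, hp, hq, add_zero]
  · simp
  · intro x y _ _ hx hy q
    rw [mul_add, map_add, hx, hy, add_zero]
  · intro c x _ hx q
    rw [smul_eq_mul, ← mul_assoc, hx]

lemma Phi_dual (a a' : Fin d ↪o Fin m) (b b' : Fin d ↪o Fin n) :
    Phi a b (monomial (expo a' b') 1) = if a = a' ∧ b = b' then 1 else 0 := by
  classical
  have key : ∀ σ : Equiv.Perm (Fin d), expo a' b' = expo a (b ∘ σ) ↔
      (a = a' ∧ b = b' ∧ σ = 1) := by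
    intro σ
    constructor
    · intro h
      have hmem : ∀ p, (∃ k, (a' k, b' k) = p) ↔ ∃ k, (a k, (b ∘ σ) k) = p := by
        intro p
        rw [← expo_apply_ne, ← expo_apply_ne, h]
      have hr : Set.range a = Set.range a' := by
        ext i
        constructor
        · rintro ⟨k, rfl⟩
          obtain ⟨l, hl⟩ := (hmem _).2 ⟨k, rfl⟩
          exact ⟨l, congrArg Prod.fst hl⟩
        · rintro ⟨k, rfl⟩
          obtain ⟨l, hl⟩ := (hmem _).1 ⟨k, rfl⟩
          exact ⟨l, congrArg Prod.fst hl⟩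
      have haa : a = a' := by
        apply DFunLike.coe_injective
        exact (StrictMono.range_inj a.strictMono a'.strictMono).1 hr
      have hr' : Set.range b = Set.range b' := by
        ext i
        constructor
        · rintro ⟨k, rfl⟩
          obtain ⟨l, hl⟩ := (hmem _).2 ⟨σ.symm k, rfl⟩
          exact ⟨l, by simpa using congrArg Prod.snd hl⟩
        · rintro ⟨k, rfl⟩
          obtain ⟨l, hl⟩ := (hmem _).1 ⟨k, rfl⟩
          exact ⟨σ l, congrArg Prod.snd hl⟩
      have hbb : b = b' := by
        apply DFunLike.coe_injective
        exact (StrictMono.range_inj b.strictMono b'.strictMono).1 hr'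
      refine ⟨haa, hbb, ?_⟩
      subst haa hbb
      ext k
      obtain ⟨l, hl⟩ := (hmem _).1 ⟨k, rfl⟩
      simp only [Prod.mk.injEq, Function.comp] at hl
      have h1 := a.injective hl.1
      have h2 := b.injective hl.2
      subst h1
      simp [h2]
    · rintro ⟨rfl, rfl, rfl⟩
      rfl
  rw [Phi_monomial]
  simp only [key]
  by_cases h : a = a' ∧ b = b'
  · obtain ⟨rfl, rfl⟩ := h
    simp
  · rw [if_neg h]
    refine Finset.sum_eq_zero fun σ _ => ?_
    rw [if_neg, mul_zero]
    exact fun hall => h ⟨hall.1, hall.2.1⟩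

/-- The quotient in the theorem. -/
abbrev Q (m n d : ℕ) : Type :=
  ↥(homogeneousSubmodule (Fin m × Fin n) ℂ d) ⧸
        Submodule.comap (homogeneousSubmodule (Fin m × Fin n) ℂ d).subtype
          (Submodule.restrictScalars ℂ (I2bar m n))

/-- product as homogeneous element -/
noncomputable def Xt (α : Fin d → Fin m) (β : Fin d → Fin n) :
    ↥(homogeneousSubmodule (Fin m × Fin n) ℂ d) :=
  ⟨∏ k, X (α k, β k), by
    rw [mem_homogeneousSubmodule]
    have := IsHomogeneous.prod (R := ℂ) Finset.univ (fun k : Fin d => X (α k, β k)) (fun _ => 1)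
      (fun k _ => isHomogeneous_X ℂ (α k, β k))
    simpa using this⟩

/-- its class -/
noncomputable def T (α : Fin d → Fin m) (β : Fin d → Fin n) : Q m n d :=
  Submodule.Quotient.mk (Xt α β)

lemma T_swap (α : Fin d → Fin m) (β : Fin d → Fin n) (k k' : Fin d) (hk : k ≠ k') :
    T (α ∘ Equiv.swap k k') β = - T α β := by
  classical
  rw [eq_neg_iff_add_eq_zero, T, T, ← Submodule.Quotient.mk_add, Submodule.Quotient.mk_eq_zero]
  change ((∏ l, X ((α ∘ Equiv.swap k k') l, β l)) + ∏ l, X (α l, β l) :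
    MvPolynomial (Fin m × Fin n) ℂ) ∈ I2bar m n
  have split : ∀ c : Fin d → Fin m, (∏ l, X (c l, β l) : MvPolynomial (Fin m × Fin n) ℂ) =
      (∏ l ∈ (Finset.univ.erase k).erase k', X (c l, β l)) *
      (X (c k, β k) * X (c k', β k')) := by
    intro c
    rw [← Finset.prod_erase_mul _ _ (Finset.mem_univ k),
      ← Finset.prod_erase_mul (Finset.univ.erase k) _
        (Finset.mem_erase.2 ⟨hk.symm, Finset.mem_univ k'⟩)]
    ring
  have h : (∏ l ∈ (Finset.univ.erase k).erase k', X ((α ∘ Equiv.swap k k') l, β l) :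
      MvPolynomial (Fin m × Fin n) ℂ) =
      ∏ l ∈ (Finset.univ.erase k).erase k', X (α l, β l) := by
    refine Finset.prod_congr rfl fun l hl => ?_
    simp only [Finset.mem_erase] at hl
    rw [Function.comp, Equiv.swap_apply_of_ne_of_ne hl.2.1 hl.1]
  rw [split, split α, h, ← mul_add]
  apply Ideal.mul_mem_left
  simp only [Function.comp, Equiv.swap_apply_left, Equiv.swap_apply_right]
  convert rel_mem (α k) (α k') (β k) (β k') using 1
  ring

lemma T_comp (α : Fin d → Fin m) (β : Fin d → Fin n) (σ : Equiv.Perm (Fin d)) :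
    T (α ∘ σ) (β ∘ σ) = T α β := by
  rw [T, T]
  congr 1
  apply Subtype.ext
  exact Equiv.prod_comp σ (fun k => (X (α k, β k) : MvPolynomial (Fin m × Fin n) ℂ))

lemma T_swap' (α : Fin d → Fin m) (β : Fin d → Fin n) (k k' : Fin d) (hk : k ≠ k') :
    T α (β ∘ Equiv.swap k k') = - T α β := by
  rw [← T_swap α β k k' hk, ← T_comp α (β ∘ Equiv.swap k k') (Equiv.swap k k')]
  congr 1
  funext x
  simp

lemma T_perm (α : Fin d → Fin m) (β : Fin d → Fin n) (σ : Equiv.Perm (Fin d))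
    (P : Submodule ℂ (Q m n d)) (h : T (α ∘ σ) β ∈ P) : T α β ∈ P := by
  induction σ using Equiv.Perm.swap_induction_on' with
  | one => exact h
  | mul_swap f x y hxy ih =>
    apply ih
    have := T_swap (α ∘ f) β x y hxy
    rw [show α ∘ (f * Equiv.swap x y : Equiv.Perm (Fin d)) = (α ∘ f) ∘ Equiv.swap x y from rfl,
      this] at h
    simpa using h

lemma T_perm' (α : Fin d → Fin m) (β : Fin d → Fin n) (σ : Equiv.Perm (Fin d))
    (P : Submodule ℂ (Q m n d)) (h : T α (β ∘ σ) ∈ P) : T α β ∈ P := by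
  induction σ using Equiv.Perm.swap_induction_on' with
  | one => exact h
  | mul_swap f x y hxy ih =>
    apply ih
    have := T_swap' α (β ∘ f) x y hxy
    rw [show β ∘ (f * Equiv.swap x y : Equiv.Perm (Fin d)) = (β ∘ f) ∘ Equiv.swap x y from rfl,
      this] at h
    simpa using h

lemma comp_swap_eq {γ : Type*} (α : Fin d → γ) (k k' : Fin d) (h : α k = α k') :
    α ∘ Equiv.swap k k' = α := by
  funext x
  simp only [Function.comp, Equiv.swap_apply_def]
  split_ifs <;> simp_all

lemma self_eq_neg_zero (x : Q m n d) (h : x = -x) : x = 0 := by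
  have h2 : (2 : ℂ) • x = 0 := by
    rw [two_smul]
    exact eq_neg_iff_add_eq_zero.1 h
  exact (smul_eq_zero.1 h2).resolve_left two_ne_zero

lemma T_zero (α : Fin d → Fin m) (β : Fin d → Fin n) (h : ¬ Function.Injective α) :
    T α β = 0 := by
  simp only [Function.Injective, not_forall] at h
  obtain ⟨k, k', h, hk⟩ := h
  have := T_swap α β k k' hk
  rw [comp_swap_eq α k k' h] at this
  exact self_eq_neg_zero _ this

lemma T_zero' (α : Fin d → Fin m) (β : Fin d → Fin n) (h : ¬ Function.Injective β) :
    T α β = 0 := by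
  simp only [Function.Injective, not_forall] at h
  obtain ⟨k, k', h, hk⟩ := h
  have := T_swap' α β k k' hk
  rw [comp_swap_eq β k k' h] at this
  exact self_eq_neg_zero _ this

/-- The basis family. -/
noncomputable def v (m n d : ℕ) : (Fin d ↪o Fin m) × (Fin d ↪o Fin n) → Q m n d :=
  fun p => T p.1 p.2

lemma T_mem (α : Fin d → Fin m) (β : Fin d → Fin n) :
    T α β ∈ Submodule.span ℂ (Set.range (v m n d)) := by
  by_cases hα : Function.Injective α
  swap
  · rw [T_zero α β hα]; exact zero_mem _
  by_cases hβ : Function.Injective β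
  swap
  · rw [T_zero' α β hβ]; exact zero_mem _
  apply T_perm α β (Tuple.sort α)
  apply T_perm' _ β (Tuple.sort β)
  apply Submodule.subset_span
  have h1 : StrictMono (α ∘ Tuple.sort α) :=
    (Tuple.monotone_sort α).strictMono_of_injective (hα.comp (Equiv.injective _))
  have h2 : StrictMono (β ∘ Tuple.sort β) :=
    (Tuple.monotone_sort β).strictMono_of_injective (hβ.comp (Equiv.injective _))
  exact ⟨(OrderEmbedding.ofStrictMono _ h1, OrderEmbedding.ofStrictMono _ h2), rfl⟩

lemma span_top : ⊤ ≤ Submodule.span ℂ (Set.range (v m n d)) := by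
  rintro x -
  obtain ⟨⟨f, hf⟩, rfl⟩ := Submodule.Quotient.mk_surjective _ x
  have hf' := (mem_homogeneousSubmodule d f).1 hf
  have hex : ∀ s ∈ f.support, ∃ (α : Fin d → Fin m) (β : Fin d → Fin n), s = expo α β := by
    intro s hs
    apply exists_expo
    have := hf' (mem_support_iff.1 hs)
    rwa [Pi.one_def, ← Finsupp.degree_eq_weight_one] at this
  have hsum : (⟨f, hf⟩ : ↥(homogeneousSubmodule (Fin m × Fin n) ℂ d)) ∈
      Submodule.span ℂ (Set.range fun p : (Fin d → Fin m) × (Fin d → Fin n) => Xt p.1 p.2) := by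
    suffices hh : f ∈ (Submodule.span ℂ (Set.range
        fun p : (Fin d → Fin m) × (Fin d → Fin n) => Xt p.1 p.2)).map
          (homogeneousSubmodule (Fin m × Fin n) ℂ d).subtype by
      obtain ⟨y, hy, hyf⟩ := hh
      have : y = ⟨f, hf⟩ := Subtype.ext hyf
      rwa [← this]
    rw [Submodule.map_span]
    rw [f.as_sum]
    refine Submodule.sum_mem _ fun s hs => ?_
    obtain ⟨α, β, h⟩ := hex s hs
    have : monomial s (coeff s f) = (coeff s f) • (monomial s (1 : ℂ)) := by
      rw [smul_monomial, smul_eq_mul, mul_one]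
    rw [this]
    apply Submodule.smul_mem
    apply Submodule.subset_span
    refine ⟨Xt α β, ⟨(α, β), rfl⟩, ?_⟩
    rw [h, ← prod_eq]
    rfl
  have h2 : Submodule.span ℂ
      (Set.range fun p : (Fin d → Fin m) × (Fin d → Fin n) => Xt p.1 p.2) ≤
      (Submodule.span ℂ (Set.range (v m n d))).comap (Submodule.mkQ _) := by
    rw [Submodule.span_le]
    rintro _ ⟨p, rfl⟩
    exact T_mem p.1 p.2
  exact h2 hsum

lemma lin_indep : LinearIndependent ℂ (v m n d) := by
  classical
  rw [Fintype.linearIndependent_iff]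
  intro g hg p
  have h1 : Submodule.Quotient.mk (p := Submodule.comap
      (homogeneousSubmodule (Fin m × Fin n) ℂ d).subtype
          (Submodule.restrictScalars ℂ (I2bar m n)))
      (∑ q, g q • Xt q.1 q.2) = 0 := by
    rw [← hg, ← Submodule.mkQ_apply, map_sum]
    rfl
  rw [Submodule.Quotient.mk_eq_zero] at h1
  have h2 := Phi_ideal p.1 p.2 p.1.injective p.2.injective _ h1
  rw [map_sum, map_sum] at h2
  have h3 : ∀ q : (Fin d ↪o Fin m) × (Fin d ↪o Fin n),
      Phi p.1 p.2 ((homogeneousSubmodule (Fin m × Fin n) ℂ d).subtype (g q • Xt q.1 q.2)) =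
      if p = q then g q else 0 := by
    intro q
    rw [map_smul, map_smul]
    change _ • Phi p.1 p.2 (∏ k, X (q.1 k, q.2 k)) = _
    rw [prod_eq, Phi_dual]
    simp [Prod.ext_iff]
  rw [Finset.sum_congr rfl fun q _ => h3 q] at h2
  simpa using h2

lemma card_emb (m d : ℕ) : Fintype.card (Fin d ↪o Fin m) = m.choose d := by
  rw [← Nat.card_eq_fintype_card, Nat.card_congr Set.powersetCard.ofFinEmbEquiv,
    Set.powersetCard.card, Nat.card_eq_fintype_card, Fintype.card_fin]

/-- The basis. -/
noncomputable def bas (m n d : ℕ) :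
    Module.Basis ((Fin d ↪o Fin m) × (Fin d ↪o Fin n)) ℂ (Q m n d) :=
  Module.Basis.mk lin_indep span_top

lemma finrank_Q (m n d : ℕ) : Module.finrank ℂ (Q m n d) = m.choose d * n.choose d := by
  rw [Module.finrank_eq_card_basis (bas m n d), Fintype.card_prod, card_emb, card_emb]

end PermProof

/-- For every `d`, the space `S_d / (Ī₂)_d` has dimension `C(m,d)·C(n,d)`;
in particular `(Ī₂)_d = S_d` whenever `d > min m n`. -/
theorem dim_quotient_by_permanents (m n : ℕ) (hm : 1 ≤ m) (hn : 1 ≤ n) (d : ℕ) :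
    Module.finrank ℂ
      (↥(homogeneousSubmodule (Fin m × Fin n) ℂ d) ⧸
        Submodule.comap (homogeneousSubmodule (Fin m × Fin n) ℂ d).subtype
          (Submodule.restrictScalars ℂ (I2bar m n))) =
      Nat.choose m d * Nat.choose n d ∧
    (min m n < d →
      Submodule.restrictScalars ℂ (I2bar m n) ⊓ homogeneousSubmodule (Fin m × Fin n) ℂ d =
        homogeneousSubmodule (Fin m × Fin n) ℂ d) := by
  refine ⟨PermProof.finrank_Q m n d, fun h => ?_⟩
  have h0 : Module.finrank ℂ (PermProof.Q m n d) = 0 := by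
    rw [PermProof.finrank_Q]
    rcases min_lt_iff.1 h with h | h
    · rw [Nat.choose_eq_zero_of_lt h, zero_mul]
    · rw [Nat.choose_eq_zero_of_lt h, mul_zero]
  have : Module.Finite ℂ (PermProof.Q m n d) := Module.Finite.of_basis (PermProof.bas m n d)
  have hs : Subsingleton (PermProof.Q m n d) := Module.finrank_zero_iff.1 h0
  rw [inf_eq_right]
  intro f hf
  have := (Submodule.Quotient.mk_eq_zero _).1
    (Subsingleton.elim (Submodule.Quotient.mk ⟨f, hf⟩ : PermProof.Q m n d) 0)
  exact this
end

section
/- The space Syz_3 of linear syzygies of the 2×2 minors (families (c_w) of linear forms with Σ_w c_w Δ_w = 0) has dimension (m(m²−1)/3)·binom(n,3) + binom(m,3)·(n(n²−1)/3). -/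
open MvPolynomial

/-- Index set for the 2×2 minors of a generic `m × n` matrix:
quadruples `((i,i'),(j,j'))` with `i < i'` and `j < j'`. -/
def MinorIdx (m n : ℕ) : Type :=
  {w : (Fin m × Fin m) × (Fin n × Fin n) // w.1.1 < w.1.2 ∧ w.2.1 < w.2.2}

instance (m n : ℕ) : Fintype (MinorIdx m n) := by unfold MinorIdx; infer_instance

instance (m n : ℕ) : DecidableEq (MinorIdx m n) := by unfold MinorIdx; infer_instance

/-- The 2×2 minor `Δ_{(i,i'),(j,j')} = x_{i,j} x_{i',j'} - x_{i,j'} x_{i',j}`. -/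
noncomputable def minorΔ {m n : ℕ} (w : MinorIdx m n) : MvPolynomial (Fin m × Fin n) ℂ :=
  X (w.1.1.1, w.1.2.1) * X (w.1.1.2, w.1.2.2) - X (w.1.1.1, w.1.2.2) * X (w.1.1.2, w.1.2.1)

/-- `Syz_d`: the ℂ-vector space of degree-`d` syzygies of the 2×2 minors, i.e.
families `c = (c_w)` of homogeneous polynomials of degree `d - 2` with
`∑_w c_w Δ_w = 0`. -/
noncomputable def Syz (m n d : ℕ) :
    Submodule ℂ (MinorIdx m n → MvPolynomial (Fin m × Fin n) ℂ) where
  carrier := {c | (∀ w, c w ∈ homogeneousSubmodule (Fin m × Fin n) ℂ (d - 2)) ∧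
    ∑ w, c w * minorΔ w = 0}
  zero_mem' := by
    refine ⟨fun w => Submodule.zero_mem _, ?_⟩
    simp
  add_mem' := by
    rintro a b ⟨ha1, ha2⟩ ⟨hb1, hb2⟩
    refine ⟨fun w => Submodule.add_mem _ (ha1 w) (hb1 w), ?_⟩
    simp only [Pi.add_apply, add_mul]
    rw [Finset.sum_add_distrib, ha2, hb2, add_zero]
  smul_mem' := by
    rintro r a ⟨ha1, ha2⟩
    refine ⟨fun w => Submodule.smul_mem _ r (ha1 w), ?_⟩
    simp only [Pi.smul_apply, smul_mul_assoc]
    rw [← Finset.smul_sum, ha2, smul_zero]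

namespace SyzAux

variable {m n : ℕ}

/-- unordered triple -/
def tri {α : Type*} (p q r : α) : Sym α 3 := ⟨{p, q, r}, rfl⟩

lemma tri_swap12 {α : Type*} (p q r : α) : tri p q r = tri q p r := by
  apply Subtype.ext
  change p ::ₘ q ::ₘ {r} = q ::ₘ p ::ₘ {r}
  exact Multiset.cons_swap _ _ _

lemma tri_swap23 {α : Type*} (p q r : α) : tri p q r = tri p r q := by
  apply Subtype.ext
  change p ::ₘ q ::ₘ {r} = p ::ₘ r ::ₘ {q}
  rw [← Multiset.cons_zero r, Multiset.cons_swap q r]; rfl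

lemma exists_tri {α : Type*} (a : Sym α 3) : ∃ p q r, a = tri p q r := by
  obtain ⟨s, hs⟩ := a
  obtain ⟨p, q, r, h⟩ := Multiset.card_eq_three.1 hs
  exact ⟨p, q, r, Subtype.ext h⟩

lemma tri_map {α β : Type*} (f : α → β) (p q r : α) :
    Sym.map f (tri p q r) = tri (f p) (f q) (f r) := by
  apply Subtype.ext
  simp [tri]

lemma tri_eq {α : Type*} {a b c x y z : α} (h : tri a b c = tri x y z) :
    (a = x ∧ b = y ∧ c = z) ∨ (a = x ∧ b = z ∧ c = y) ∨ (a = y ∧ b = x ∧ c = z) ∨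
    (a = y ∧ b = z ∧ c = x) ∨ (a = z ∧ b = x ∧ c = y) ∨ (a = z ∧ b = y ∧ c = x) := by
  classical
  have h1 : ([a, b, c] : List α).Perm [x, y, z] := by
    have := congrArg Subtype.val h
    exact Multiset.coe_eq_coe.1 this
  have h2 := List.mem_permutations.2 h1
  simp [List.permutations, List.permutationsAux, List.permutationsAux.rec,
    List.permutationsAux2] at h2
  tauto

/-- images of basis vectors -/
noncomputable def v (k : MinorIdx m n × (Fin m × Fin n)) : Sym (Fin m × Fin n) 3 →₀ ℂ :=
  Finsupp.single (tri k.2 (k.1.1.1.1, k.1.1.2.1) (k.1.1.1.2, k.1.1.2.2)) 1 -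
  Finsupp.single (tri k.2 (k.1.1.1.1, k.1.1.2.2) (k.1.1.1.2, k.1.1.2.1)) 1

/-- Segre projection. -/
def seg (a : Sym (Fin m × Fin n) 3) : Sym (Fin m) 3 × Sym (Fin n) 3 :=
  (a.map Prod.fst, a.map Prod.snd)

noncomputable def T (m n : ℕ) :
    (MinorIdx m n × (Fin m × Fin n) → ℂ) →ₗ[ℂ] (Sym (Fin m × Fin n) 3 →₀ ℂ) :=
  Fintype.linearCombination ℂ v

lemma v_mem (k : MinorIdx m n × (Fin m × Fin n)) : v k ∈ LinearMap.range (T m n) := by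
  rw [T, Fintype.range_linearCombination]
  exact Submodule.subset_span ⟨k, rfl⟩

/-- equivalence modulo the range -/
def Rel (a b : Sym (Fin m × Fin n) 3) : Prop :=
  (Finsupp.single a 1 - Finsupp.single b 1 : Sym (Fin m × Fin n) 3 →₀ ℂ) ∈ LinearMap.range (T m n)

lemma Rel.refl (a : Sym (Fin m × Fin n) 3) : Rel a a := by
  unfold Rel; simp only [sub_self]; exact Submodule.zero_mem _

lemma Rel.symm {a b : Sym (Fin m × Fin n) 3} (h : Rel a b) : Rel b a := by
  unfold Rel at *
  rw [← neg_sub]; exact Submodule.neg_mem _ h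

lemma Rel.trans {a b c : Sym (Fin m × Fin n) 3} (h : Rel a b) (h' : Rel b c) : Rel a c := by
  unfold Rel at *
  rw [← sub_add_sub_cancel]; exact Submodule.add_mem _ h h'

lemma rel_swap23_aux (p : Fin m × Fin n) (i i' : Fin m) (j j' : Fin n) (hi : i < i') :
    Rel (tri p (i, j) (i', j')) (tri p (i, j') (i', j)) := by
  rcases lt_trichotomy j j' with h | h | h
  · exact v_mem (⟨((i, i'), (j, j')), hi, h⟩, p)
  · subst h; exact Rel.refl _
  · exact Rel.symm (v_mem (⟨((i, i'), (j', j)), hi, h⟩, p))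

lemma rel_swap23 (p : Fin m × Fin n) (i i' : Fin m) (j j' : Fin n) :
    Rel (tri p (i, j) (i', j')) (tri p (i, j') (i', j)) := by
  rcases lt_trichotomy i i' with h | h | h
  · exact rel_swap23_aux p i i' j j' h
  · subst h; rw [tri_swap23]; exact Rel.refl _
  · rw [tri_swap23 p, tri_swap23 p (i, j')]; exact rel_swap23_aux p i' i j' j h

lemma rel_swap12 (p : Fin m × Fin n) (i i' : Fin m) (j j' : Fin n) :
    Rel (tri (i, j) (i', j') p) (tri (i, j') (i', j) p) := by
  have := rel_swap23 p i i' j j'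
  rwa [tri_swap12, tri_swap23, tri_swap12 p, tri_swap23 _ p] at this

lemma rel_snd {i1 i2 i3 : Fin m} {a b c x y z : Fin n} (h : tri a b c = tri x y z) :
    Rel (tri (i1, a) (i2, b) (i3, c)) (tri (i1, x) (i2, y) (i3, z)) := by
  rcases tri_eq h with ⟨rfl, rfl, rfl⟩ | ⟨rfl, rfl, rfl⟩ | ⟨rfl, rfl, rfl⟩ | ⟨rfl, rfl, rfl⟩ |
    ⟨rfl, rfl, rfl⟩ | ⟨rfl, rfl, rfl⟩
  · exact Rel.refl _
  · exact rel_swap23 _ _ _ _ _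
  · exact rel_swap12 _ _ _ _ _
  · exact (rel_swap23 _ _ _ _ _).trans (rel_swap12 _ _ _ _ _)
  · exact (rel_swap12 _ _ _ _ _).trans (rel_swap23 _ _ _ _ _)
  · exact (rel_swap12 _ _ _ _ _).trans ((rel_swap23 _ _ _ _ _).trans (rel_swap12 _ _ _ _ _))

lemma rel_of_seg {a b : Sym (Fin m × Fin n) 3} (h : seg a = seg b) : Rel a b := by
  obtain ⟨⟨i1, j1⟩, ⟨i2, j2⟩, ⟨i3, j3⟩, rfl⟩ := exists_tri a
  obtain ⟨⟨k1, l1⟩, ⟨k2, l2⟩, ⟨k3, l3⟩, rfl⟩ := exists_tri b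
  simp only [seg, tri_map, Prod.mk.injEq] at h
  obtain ⟨h1, h2⟩ := h
  rcases tri_eq h1 with ⟨rfl, rfl, rfl⟩ | ⟨rfl, rfl, rfl⟩ | ⟨rfl, rfl, rfl⟩ | ⟨rfl, rfl, rfl⟩ |
    ⟨rfl, rfl, rfl⟩ | ⟨rfl, rfl, rfl⟩
  · exact rel_snd h2
  · rw [tri_swap23 (i1, l1)]; rw [tri_swap23 l1] at h2; exact rel_snd h2
  · rw [tri_swap12 (i2, l1)]; rw [tri_swap12 l1] at h2; exact rel_snd h2
  · rw [tri_swap12 (i3, l1), tri_swap23 (i1, l2)]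
    rw [tri_swap12 l1, tri_swap23 l2] at h2; exact rel_snd h2
  · rw [tri_swap23 (i2, l1), tri_swap12 (i2, l1)]
    rw [tri_swap23 l1, tri_swap12 l1] at h2; exact rel_snd h2
  · rw [tri_swap12 (i3, l1), tri_swap23 (i2, l2), tri_swap12 (i2, l2)]
    rw [tri_swap12 l1, tri_swap23 l2, tri_swap12 l2] at h2; exact rel_snd h2

lemma seg_surj : Function.Surjective (seg (m := m) (n := n)) := by
  rintro ⟨a, b⟩
  obtain ⟨i1, i2, i3, rfl⟩ := exists_tri a
  obtain ⟨j1, j2, j3, rfl⟩ := exists_tri b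
  exact ⟨tri (i1, j1) (i2, j2) (i3, j3), by simp [seg, tri_map]⟩

lemma range_T : LinearMap.range (T m n) = LinearMap.ker (Finsupp.lmapDomain ℂ ℂ (seg (m := m) (n := n))) := by
  apply le_antisymm
  · rw [T, Fintype.range_linearCombination, Submodule.span_le]
    rintro _ ⟨k, rfl⟩
    simp only [v, SetLike.mem_coe, LinearMap.mem_ker, map_sub, Finsupp.lmapDomain_apply,
      Finsupp.mapDomain_single, seg, tri_map]
    rw [tri_swap23 k.2.2 k.1.1.2.2]
    simp
  · intro x hx
    obtain ⟨s, hs⟩ := seg_surj (m := m) (n := n).hasRightInverse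
    have key : ∀ x : Sym (Fin m × Fin n) 3 →₀ ℂ,
        x - Finsupp.lmapDomain ℂ ℂ s (Finsupp.lmapDomain ℂ ℂ seg x) ∈ LinearMap.range (T m n) := by
      intro x
      induction x using Finsupp.induction_linear with
      | zero => simp
      | add f g hf hg =>
        have := Submodule.add_mem _ hf hg
        rw [map_add, map_add]
        convert this using 1
        abel
      | single a b =>
        have h : Rel a (s (seg a)) := rel_of_seg (hs (seg a)).symm
        have := Submodule.smul_mem _ b h
        convert this using 1
        simp [smul_sub]
    have := key x
    rw [LinearMap.mem_ker.1 hx] at this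
    simpa using this

lemma finrank_ker_T : Module.finrank ℂ (LinearMap.ker (T m n)) + Fintype.card (Sym (Fin m × Fin n) 3)
    = Fintype.card (MinorIdx m n × (Fin m × Fin n)) +
      Fintype.card (Sym (Fin m) 3 × Sym (Fin n) 3) := by
  have h1 := LinearMap.finrank_range_add_finrank_ker (T m n)
  have h2 := LinearMap.finrank_range_add_finrank_ker (Finsupp.lmapDomain ℂ ℂ (seg (m := m) (n := n)))
  have h3 : LinearMap.range (Finsupp.lmapDomain ℂ ℂ (seg (m := m) (n := n))) = ⊤ :=
    LinearMap.range_eq_top.2 (Finsupp.mapDomain_surjective seg_surj)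
  rw [h3, finrank_top, Module.finrank_finsupp_self, Module.finrank_finsupp_self] at h2
  rw [Module.finrank_fintype_fun_eq_card, range_T] at h1
  omega

lemma card_pairs (k : ℕ) : Fintype.card {p : Fin k × Fin k // p.1 < p.2} = k.choose 2 := by
  rw [Fintype.card_subtype]
  have h : ∀ k : ℕ, ∑ x : Fin k, (x : ℕ) = k.choose 2 := by
    intro k; rw [Fin.sum_univ_eq_sum_range (fun i => i) k, Finset.sum_range_id, Nat.choose_two_right]
  rw [← h, Finset.card_filter, Fintype.sum_prod_type_right]
  refine Finset.sum_congr rfl fun y _ => ?_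
  rw [← Finset.card_filter]
  change (Finset.univ.filter (fun x => x < y)).card = y
  have e : Finset.univ.filter (fun x => x < y) = Finset.Iio y := by ext; simp
  rw [e, Fin.card_Iio]

lemma card_minorIdx : Fintype.card (MinorIdx m n) = m.choose 2 * n.choose 2 := by
  rw [← card_pairs, ← card_pairs, ← Fintype.card_prod]
  refine Fintype.card_congr ⟨fun w => (⟨w.1.1, w.2.1⟩, ⟨w.1.2, w.2.2⟩),
    fun q => ⟨(q.1.1, q.2.1), q.1.2, q.2.2⟩, fun _ => rfl, fun _ => rfl⟩

/-- the embedding of coefficient arrays in families of linear forms -/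
noncomputable def L (m n : ℕ) : (MinorIdx m n × (Fin m × Fin n) → ℂ) →ₗ[ℂ]
    (MinorIdx m n → MvPolynomial (Fin m × Fin n) ℂ) where
  toFun d := fun w => ∑ p, C (d (w, p)) * X p
  map_add' a b := by
    funext w; simp [add_mul, Finset.sum_add_distrib]
  map_smul' r a := by
    funext w; simp [Finset.smul_sum, smul_eq_C_mul, mul_assoc]

lemma coeff_lin (f : Fin m × Fin n → ℂ) (q : Fin m × Fin n) :
    coeff (Finsupp.single q 1) (∑ p, C (f p) * X p : MvPolynomial (Fin m × Fin n) ℂ) = f q := by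
  classical
  simp [coeff_sum, coeff_C_mul, coeff_X, Finsupp.single_left_inj]

lemma L_inj : Function.Injective (L m n) := by
  intro a b h
  funext ⟨w, q⟩
  have := congrArg (coeff (Finsupp.single q 1)) (congrFun h w)
  simpa only [L, LinearMap.coe_mk, AddHom.coe_mk, coeff_lin (fun p => a (w, p)),
    coeff_lin (fun p => b (w, p))] using this

lemma deg_one {σ : Type*} (d : σ →₀ ℕ) (hd : d.degree = 1) : ∃ p, d = Finsupp.single p 1 := by
  classical
  have h : Multiset.card (Finsupp.toMultiset d) = 1 := by
    rw [Finsupp.card_toMultiset, ← hd]; rfl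
  obtain ⟨p, hp⟩ := Multiset.card_eq_one.1 h
  refine ⟨p, ?_⟩
  rw [← Finsupp.toMultiset_toFinsupp d, hp, Multiset.toFinsupp_singleton]

lemma lin_eq (c : MvPolynomial (Fin m × Fin n) ℂ) (hc : c.IsHomogeneous 1) :
    ∑ p, C (coeff (Finsupp.single p 1) c) * X p = c := by
  classical
  ext d
  by_cases hd : d.degree = 1
  · obtain ⟨p, rfl⟩ := deg_one d hd
    rw [coeff_lin]
  · rw [hc.coeff_eq_zero hd]
    have : (∑ p, C (coeff (Finsupp.single p 1) c) * X p : MvPolynomial (Fin m × Fin n) ℂ).IsHomogeneous 1 := by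
      apply IsHomogeneous.sum
      intro p _
      simpa using (isHomogeneous_C _ _).mul (isHomogeneous_X ℂ p)
    exact this.coeff_eq_zero hd

/-- monomial attached to a triple, linearly extended -/
noncomputable def E (m n : ℕ) : (Sym (Fin m × Fin n) 3 →₀ ℂ) →ₗ[ℂ] MvPolynomial (Fin m × Fin n) ℂ :=
  Finsupp.linearCombination ℂ (fun a => monomial (Multiset.toFinsupp a.1) (1 : ℂ))

lemma E_inj : Function.Injective (E m n) := by
  have h := (basisMonomials (Fin m × Fin n) ℂ).linearIndependent.comp
    (fun a : Sym (Fin m × Fin n) 3 => Multiset.toFinsupp a.1)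
    (fun a b h => Subtype.ext (Multiset.toFinsupp.injective h))
  rw [coe_basisMonomials] at h
  exact h

lemma E_tri (p q r : Fin m × Fin n) : E m n (Finsupp.single (tri p q r) 1) = X p * (X q * X r) := by
  simp only [E, Finsupp.linearCombination_single, one_smul, X, monomial_mul, one_mul]
  have : Multiset.toFinsupp (tri p q r).1 =
      Finsupp.single p 1 + (Finsupp.single q 1 + Finsupp.single r 1) := by
    change Multiset.toFinsupp ({p} + ({q} + {r})) = _
    simp only [map_add, Multiset.toFinsupp_singleton]
  rw [this]

lemma E_v (k : MinorIdx m n × (Fin m × Fin n)) : E m n (v k) = X k.2 * minorΔ k.1 := by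
  rw [v, map_sub, E_tri, E_tri, minorΔ, mul_sub]

lemma E_T (d : MinorIdx m n × (Fin m × Fin n) → ℂ) : E m n (T m n d) = ∑ w, L m n d w * minorΔ w := by
  simp only [T, Fintype.linearCombination_apply, map_sum, map_smul, E_v, Fintype.sum_prod_type, L,
    LinearMap.coe_mk, AddHom.coe_mk, Finset.sum_mul, smul_eq_C_mul, mul_assoc]

lemma syz_eq : Syz m n 3 = (LinearMap.ker (T m n)).map (L m n) := by
  ext c
  rw [Submodule.mem_map]
  constructor
  · rintro ⟨h1, h2⟩
    have hL : L m n (fun k => coeff (Finsupp.single k.2 1) (c k.1)) = c := by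
      funext w
      exact lin_eq (c w) (h1 w)
    refine ⟨_, ?_, hL⟩
    rw [LinearMap.mem_ker]
    apply E_inj
    rw [E_T, hL, map_zero, h2]
  · rintro ⟨d, hd, rfl⟩
    refine ⟨fun w => ?_, ?_⟩
    · rw [mem_homogeneousSubmodule]
      apply IsHomogeneous.sum
      intro p _
      simpa using (isHomogeneous_C _ _).mul (isHomogeneous_X ℂ p)
    · rw [← E_T, LinearMap.mem_ker.1 hd, map_zero]

lemma ch2 (k : ℕ) : (2 : ℚ) * (k.choose 2 : ℕ) = k * (k - 1) := by
  rw [Nat.cast_choose_two]; ring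

lemma ch3' (k : ℕ) : (6 : ℚ) * ((k + 2).choose 3 : ℕ) = k * (k + 1) * (k + 2) := by
  induction k with
  | zero => simp
  | succ k ih =>
    have : (k + 1 + 2).choose 3 = (k + 2).choose 2 + (k + 2).choose 3 := Nat.choose_succ_succ' _ _
    rw [this]
    have h2 := ch2 (k + 2)
    push_cast at *
    linear_combination ih + 3 * h2

lemma ch3 (k : ℕ) : (6 : ℚ) * (k.choose 3 : ℕ) = k * (k - 1) * (k - 2) := by
  match k with
  | 0 => simp
  | 1 => simp [Nat.choose]
  | k + 2 => rw [ch3']; push_cast; ring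

lemma third (k : ℕ) (hk : 1 ≤ k) : (3 : ℚ) * (k * (k ^ 2 - 1) / 3 : ℕ) = k * (k ^ 2 - 1) := by
  obtain ⟨k, rfl⟩ := Nat.exists_eq_add_of_le' hk
  have h : (k + 1) * ((k + 1) ^ 2 - 1) = 3 * (2 * (k + 2).choose 3) := by
    have e : (k + 1) ^ 2 - 1 = k * (k + 2) := by
      rw [Nat.sub_eq_iff_eq_add (by nlinarith)]; ring
    rw [e]
    have := ch3' k
    have h' : 6 * (k + 2).choose 3 = k * (k + 1) * (k + 2) := by exact_mod_cast this
    linarith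
  rw [h, Nat.mul_div_cancel_left _ (by norm_num)]
  have := ch3' k
  push_cast
  linear_combination this

lemma card_sym3 (α : Type*) [Fintype α] [DecidableEq α] :
    Fintype.card (Sym α 3) = (Fintype.card α + 2).choose 3 := by
  rw [Sym.card_sym_eq_choose]; rfl

end SyzAux

open SyzAux in
/-- The space of linear syzygies of the 2×2 minors has dimension
`(m(m²−1)/3)·C(n,3) + C(m,3)·(n(n²−1)/3)`. -/
theorem dim_linear_syzygies_minors (m n : ℕ) (hm : 1 ≤ m) (hn : 1 ≤ n) :
    Module.finrank ℂ (Syz m n 3) =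
      m * (m ^ 2 - 1) / 3 * Nat.choose n 3 +
        Nat.choose m 3 * (n * (n ^ 2 - 1) / 3) := by
  have h1 := finrank_ker_T (m := m) (n := n)
  rw [syz_eq, ← ((LinearMap.ker (T m n)).equivMapOfInjective (L m n) L_inj).finrank_eq]
  rw [card_sym3, Fintype.card_prod, Fintype.card_prod, Fintype.card_prod, Fintype.card_prod, card_sym3, card_sym3,
    card_minorIdx, Fintype.card_fin, Fintype.card_fin] at h1
  have h2 : ((Module.finrank ℂ (LinearMap.ker (T m n)) + (m * n + 2).choose 3 : ℕ) : ℚ) =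
    (m.choose 2 * n.choose 2 * (m * n) + (m + 2).choose 3 * (n + 2).choose 3 : ℕ) := by
    rw [h1]
  have e1 := ch3' (m * n)
  have e2 := ch3' m
  have e3 := ch3' n
  have e4 := ch2 m
  have e5 := ch2 n
  have e6 := ch3 m
  have e7 := ch3 n
  have e8 := third m hm
  have e9 := third n hn
  have goal : ((Module.finrank ℂ (LinearMap.ker (T m n)) : ℕ) : ℚ) =
      ((m * (m ^ 2 - 1) / 3 * Nat.choose n 3 + Nat.choose m 3 * (n * (n ^ 2 - 1) / 3) : ℕ) : ℚ) := by
    rw [Nat.cast_add, Nat.cast_mul, Nat.cast_mul]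
    rw [Nat.cast_add, Nat.cast_add, Nat.cast_mul, Nat.cast_mul, Nat.cast_mul, Nat.cast_mul] at h2
    rw [Nat.cast_mul] at e1
    generalize ((m * (m ^ 2 - 1) / 3 : ℕ) : ℚ) = t1 at *
    generalize ((n * (n ^ 2 - 1) / 3 : ℕ) : ℚ) = t2 at *
    have dv : ∀ k a b : ℚ, k ≠ 0 → k * a = b → a = b / k := by
      intro k a b hk h
      rw [← h, mul_div_cancel_left₀ _ hk]
    replace e1 := dv _ _ _ (by norm_num) e1
    replace e2 := dv _ _ _ (by norm_num) e2
    replace e3 := dv _ _ _ (by norm_num) e3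
    replace e4 := dv _ _ _ (by norm_num) e4
    replace e5 := dv _ _ _ (by norm_num) e5
    replace e6 := dv _ _ _ (by norm_num) e6
    replace e7 := dv _ _ _ (by norm_num) e7
    replace e8 := dv _ _ _ (by norm_num) e8
    replace e9 := dv _ _ _ (by norm_num) e9
    rw [e1, e2, e3, e4, e5] at h2
    rw [e6, e7, e8, e9]
    linear_combination h2
  exact_mod_cast goal
end

section
/- dim_ℂ (Syz_4 / Kos_4) = (m²(m²−1)/12)·binom(n,4) + binom(m,4)·(n²(n²−1)/12) + (m(m+1)(m−1)(m−2)/8)·(n(n+1)(n−1)(n−2)/8) + (m(m+1)(m−1)(m−2)/8)·(n(n+1)(n+2)(n−1)/8) + (m(m+1)(m+2)(m−1)/8)·(n(n+1)(n−1)(n−2)/8). (This is the degree-4 part of the first Koszul homology of the 2×2 minors.) -/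
open MvPolynomial

/-- The `S`-submodule of the free module `F = ⊕_w S·e_w` generated by the
Koszul syzygies `Δ_{w'}·e_w − Δ_w·e_{w'}`. -/
noncomputable def KosMod (m n : ℕ) :
    Submodule (MvPolynomial (Fin m × Fin n) ℂ)
      (MinorIdx m n → MvPolynomial (Fin m × Fin n) ℂ) :=
  Submodule.span _ {k | ∃ w w' : MinorIdx m n,
    k = Pi.single w (minorΔ w') - Pi.single w' (minorΔ w)}

/-- `Kos_d`: the space of degree-`d` syzygies lying in the `S`-submodule
generated by the Koszul syzygies. -/
noncomputable def Kos (m n d : ℕ) :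
    Submodule ℂ (MinorIdx m n → MvPolynomial (Fin m × Fin n) ℂ) :=
  Syz m n d ⊓ Submodule.restrictScalars ℂ (KosMod m n)

namespace KH

variable {m n : ℕ}

lemma homogComp_mul {σ : Type*} {k d : ℕ} (s q : MvPolynomial σ ℂ) (hq : q.IsHomogeneous d) :
    homogeneousComponent (k + d) (s * q) = homogeneousComponent k s * q := by
  induction s using MvPolynomial.induction_on' with
  | monomial u a =>
    have h1 : (monomial u a : MvPolynomial σ ℂ).IsHomogeneous u.degree :=
      isHomogeneous_monomial a rfl
    rw [homogeneousComponent_of_mem (h1.mul hq), homogeneousComponent_of_mem h1]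
    by_cases h : u.degree = k
    · simp [h]
    · rw [if_neg (by omega), if_neg (by omega), zero_mul]
  | add p q hp hq => rw [add_mul, map_add, hp, hq, map_add, add_mul]

lemma minor_hom (w : MinorIdx m n) : (minorΔ w).IsHomogeneous 2 :=
  ((isHomogeneous_X ℂ _).mul (isHomogeneous_X ℂ _)).sub
    ((isHomogeneous_X ℂ _).mul (isHomogeneous_X ℂ _))

lemma coeff_minor (w v : MinorIdx m n) :
    coeff (Finsupp.single (v.1.1.1, v.1.2.1) 1 + Finsupp.single (v.1.1.2, v.1.2.2) 1) (minorΔ w)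
      = if w = v then 1 else 0 := by
  obtain ⟨⟨⟨i, i'⟩, j, j'⟩, hi, hj⟩ := w
  obtain ⟨⟨⟨k, k'⟩, l, l'⟩, hk, hl⟩ := v
  simp only at hi hj hk hl
  have key : ∀ a b c d : Fin m × Fin n,
      (Finsupp.single a 1 + Finsupp.single b 1 : Fin m × Fin n →₀ ℕ)
        = Finsupp.single c 1 + Finsupp.single d 1 ↔ (a = c ∧ b = d) ∨ (a = d ∧ b = c) := by
    intro a b c d
    rw [← Multiset.toFinsupp_singleton, ← Multiset.toFinsupp_singleton,
      ← Multiset.toFinsupp_singleton, ← Multiset.toFinsupp_singleton, ← map_add, ← map_add,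
      EmbeddingLike.apply_eq_iff_eq]
    have : ∀ x y : Fin m × Fin n, ({x} + {y} : Multiset (Fin m × Fin n)) = {x, y} := fun _ _ => rfl
    rw [this, this]
    constructor
    · intro h
      rcases (Multiset.cons_eq_cons.1 h) with ⟨h1, h2⟩ | ⟨h1, t, h2, h3⟩
      · left; exact ⟨h1, by simpa using h2⟩
      · right
        have hb : b ∈ ({d} : Multiset _) ∨ b = c := by
          right
          have : c ∈ ({b} : Multiset _) := by rw [h2]; simp
          simpa [eq_comm] using this
        have ha : a ∈ ({d} : Multiset _) := by rw [h3]; simp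
        have hc : c ∈ ({b} : Multiset _) := by rw [h2]; simp
        simp at ha hc
        exact ⟨ha, hc.symm⟩
    · rintro (⟨rfl, rfl⟩ | ⟨rfl, rfl⟩)
      · rfl
      · exact Multiset.pair_comm _ _
  have hX : ∀ a b : Fin m × Fin n, (X a * X b : MvPolynomial (Fin m × Fin n) ℂ)
      = monomial (Finsupp.single a 1 + Finsupp.single b 1) 1 := by
    intro a b; simp [X, monomial_mul]
  simp only [minorΔ, hX, coeff_sub, coeff_monomial, key, MinorIdx, Subtype.mk.injEq, Prod.mk.injEq]
  have h2 : ¬ ((((i = k) ∧ j' = l) ∧ (i' = k' ∧ j = l')) ∨ ((i = k' ∧ j' = l') ∧ i' = k ∧ j = l)) := by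
    omega
  rw [if_neg h2, sub_zero]
  congr 1
  apply propext
  constructor
  · rintro (⟨⟨rfl, rfl⟩, rfl, rfl⟩ | ⟨⟨rfl, rfl⟩, rfl, rfl⟩)
    · simp
    · omega
  · rintro ⟨⟨rfl, rfl⟩, rfl, rfl⟩
    simp

lemma minor_li : LinearIndependent ℂ (minorΔ : MinorIdx m n → _) := by
  rw [Fintype.linearIndependent_iff]
  intro g hg v
  have := congrArg (coeff (Finsupp.single (v.1.1.1, v.1.2.1) 1 +
    Finsupp.single (v.1.1.2, v.1.2.2) 1)) hg
  simpa [coeff_sum, coeff_minor] using this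

lemma card_lt (α : Type*) [Fintype α] [LinearOrder α] :
    Fintype.card {p : α × α // p.1 < p.2} = (Fintype.card α).choose 2 := by
  rw [Fintype.card_subtype]
  have h1 : (Finset.univ.filter fun p : α × α => p.1 < p.2).card
      = (Finset.univ.filter fun p : α × α => p.2 < p.1).card := by
    apply Finset.card_bij' (fun p _ => p.swap) (fun p _ => p.swap) <;> simp
  have h2 : (Finset.univ.filter fun p : α × α => p.1 = p.2).card = Fintype.card α := by
    rw [← Finset.card_univ]
    symm
    apply Finset.card_bij (fun a _ => (a, a)) <;> simp
  have h3 : (Finset.univ.filter fun p : α × α => p.1 < p.2).card +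
    (Finset.univ.filter fun p : α × α => ¬ p.1 < p.2).card = Fintype.card α * Fintype.card α := by
    rw [Finset.card_filter_add_card_filter_not, Finset.card_univ, Fintype.card_prod]
  have h4 : (Finset.univ.filter fun p : α × α => ¬ p.1 < p.2) =
    (Finset.univ.filter fun p : α × α => p.2 < p.1) ∪
      (Finset.univ.filter fun p : α × α => p.1 = p.2) := by
    ext p; simp [le_iff_lt_or_eq, eq_comm]
  rw [h4, Finset.card_union_of_disjoint, ← h1, h2] at h3
  · rw [Nat.choose_two_right, Nat.mul_sub_one]; omega
  · rw [Finset.disjoint_filter]; intro p _ h h'; exact h.ne' h'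

lemma card_minorIdx : Fintype.card (MinorIdx m n) = m.choose 2 * n.choose 2 := by
  have e : MinorIdx m n ≃ {p : Fin m × Fin m // p.1 < p.2} × {p : Fin n × Fin n // p.1 < p.2} :=
    { toFun := fun w => (⟨w.1.1, w.2.1⟩, ⟨w.1.2, w.2.2⟩)
      invFun := fun p => ⟨(p.1.1, p.2.1), p.1.2, p.2.2⟩
      left_inv := fun _ => rfl
      right_inv := fun _ => rfl }
  rw [Fintype.card_congr e, Fintype.card_prod, card_lt, card_lt]; simp

/-- monomial attached to a multiset -/
noncomputable def mon {σ : Type*} (s : Multiset σ) : MvPolynomial σ ℂ := (s.map X).prod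

lemma mon_add {σ : Type*} (s t : Multiset σ) : mon (s + t) = mon s * mon t := by
  simp [mon]

lemma mon_cons {σ : Type*} (a : σ) (t : Multiset σ) : mon (a ::ₘ t) = X a * mon t := by
  simp [mon]

lemma mon_eq {σ : Type*} [DecidableEq σ] (s : Multiset σ) :
    mon s = monomial (Multiset.toFinsupp s) (1 : ℂ) := by
  induction s using Multiset.induction with
  | empty => simp [mon]
  | cons a s ih =>
    rw [mon_cons, ih, ← Multiset.singleton_add, map_add, Multiset.toFinsupp_singleton, X,
      monomial_mul, one_mul]

lemma mon_hom {σ : Type*} (s : Multiset σ) : (mon s).IsHomogeneous (Multiset.card s) := by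
  induction s using Multiset.induction with
  | empty => simpa [mon] using isHomogeneous_one σ ℂ
  | cons a s ih =>
    rw [mon_cons, Multiset.card_cons, add_comm]
    exact (isHomogeneous_X ℂ a).mul ih

lemma mon_li (σ : Type*) [DecidableEq σ] (k : ℕ) :
    LinearIndependent ℂ (fun s : Sym σ k => mon (s : Multiset σ)) := by
  have h := (basisMonomials σ ℂ).linearIndependent
  have h2 := h.comp (fun s : Sym σ k => Multiset.toFinsupp (s : Multiset σ))
    (fun a b hab => Subtype.ext (Multiset.toFinsupp.injective hab))
  have e : (fun s : Sym σ k => mon (s : Multiset σ)) = (basisMonomials σ ℂ) ∘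
      fun s : Sym σ k => Multiset.toFinsupp (s : Multiset σ) := by
    funext s
    simp [mon_eq]
  rw [e]
  exact h2

lemma hom_eq_span (σ : Type*) [DecidableEq σ] (k : ℕ) :
    homogeneousSubmodule σ ℂ k = Submodule.span ℂ (Set.range fun s : Sym σ k => mon (s : Multiset σ)) := by
  apply le_antisymm
  · intro p hp
    rw [mem_homogeneousSubmodule] at hp
    rw [p.as_sum]
    apply Submodule.sum_mem
    intro d hd
    have hd' : d.degree = k := by
      by_contra h
      exact (mem_support_iff.1 hd) (hp.coeff_eq_zero h)
    have : monomial d (coeff d p) = coeff d p • mon (Finsupp.toMultiset d) := by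
      rw [mon_eq, smul_monomial]; simp
    rw [this]
    apply Submodule.smul_mem
    apply Submodule.subset_span
    refine ⟨⟨Finsupp.toMultiset d, ?_⟩, rfl⟩
    rw [Finsupp.card_toMultiset, ← hd']; rfl
  · rw [Submodule.span_le]
    rintro _ ⟨s, rfl⟩
    have := mon_hom (s : Multiset σ)
    rw [show Multiset.card (s : Multiset σ) = k from s.2] at this
    exact this

lemma finrank_hom (σ : Type*) [DecidableEq σ] [Fintype σ] (k : ℕ) :
    Module.finrank ℂ (homogeneousSubmodule σ ℂ k) = (Fintype.card σ + k - 1).choose k := by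
  rw [hom_eq_span, finrank_span_eq_card (mon_li σ k), Sym.card_sym_eq_choose]

/-- The ideal of minors. -/
noncomputable def I (m n : ℕ) : Ideal (MvPolynomial (Fin m × Fin n) ℂ) :=
  Ideal.span (Set.range minorΔ)

lemma gen_minor_mem (i i' : Fin m) (j j' : Fin n) :
    (X (i, j) * X (i', j') - X (i, j') * X (i', j) : MvPolynomial (Fin m × Fin n) ℂ) ∈ I m n := by
  have base : ∀ (i i' : Fin m) (j j' : Fin n), i < i' → j < j' →
    (X (i, j) * X (i', j') - X (i, j') * X (i', j) : MvPolynomial (Fin m × Fin n) ℂ) ∈ I m n :=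
    fun i i' j j' hi hj => Ideal.subset_span ⟨⟨((i, i'), (j, j')), hi, hj⟩, rfl⟩
  rcases lt_trichotomy i i' with hi | rfl | hi
  · rcases lt_trichotomy j j' with hj | rfl | hj
    · exact base _ _ _ _ hi hj
    · simp
    · convert (I m n).neg_mem (base _ _ _ _ hi hj) using 1; ring
  · convert (I m n).zero_mem using 1; ring
  · rcases lt_trichotomy j j' with hj | rfl | hj
    · convert (I m n).neg_mem (base _ _ _ _ hi hj) using 1; ring
    · simp
    · convert (base _ _ _ _ hi hj) using 1; ring

lemma mon_sub_mem (s : Multiset (Fin m × Fin n)) : ∀ t : Multiset (Fin m × Fin n),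
    s.map Prod.fst = t.map Prod.fst → s.map Prod.snd = t.map Prod.snd → mon s - mon t ∈ I m n := by
  induction s using Multiset.induction with
  | empty =>
    intro t h _
    have : t = 0 := by simpa [eq_comm] using h
    simp [this]
  | cons a s ih =>
    have step : ∀ t, (a ::ₘ s).map Prod.fst = (a ::ₘ t).map Prod.fst →
        (a ::ₘ s).map Prod.snd = (a ::ₘ t).map Prod.snd → mon (a ::ₘ s) - mon (a ::ₘ t) ∈ I m n := by
      intro t h1 h2
      rw [mon_cons, mon_cons, ← mul_sub]
      apply Ideal.mul_mem_left
      apply ih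
      · simpa using h1
      · simpa using h2
    intro t h1 h2
    by_cases ha : a ∈ t
    · obtain ⟨t', rfl⟩ := Multiset.exists_cons_of_mem ha
      exact step t' h1 h2
    · have m1 : a.1 ∈ t.map Prod.fst := by rw [← h1]; simp
      have m2 : a.2 ∈ t.map Prod.snd := by rw [← h2]; simp
      obtain ⟨b, hb, hb1⟩ := Multiset.mem_map.1 m1
      obtain ⟨c, hc, hc1⟩ := Multiset.mem_map.1 m2
      obtain ⟨t', rfl⟩ := Multiset.exists_cons_of_mem hb
      have hcb : c ≠ b := by
        rintro rfl
        exact ha (by rw [← show c = a from Prod.ext hb1 hc1]; exact hc)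
      obtain ⟨t'', rfl⟩ := Multiset.exists_cons_of_mem
        ((Multiset.mem_cons.1 hc).resolve_left hcb)
      obtain ⟨i, j⟩ := a
      obtain ⟨i₁, j'⟩ := b
      obtain ⟨i', j₁⟩ := c
      simp only at hb1 hc1
      subst hb1 hc1
      have := step ((i', j') ::ₘ t'') (by rw [h1]; simp) (by rw [h2]; simp [Multiset.cons_swap])
      have h3 := (I m n).mul_mem_left (mon t'') (gen_minor_mem i₁ i' j₁ j')
      convert (I m n).add_mem this h3 using 1
      simp only [mon_cons]
      ring

/-- Target space of the (linearized) Segre map. -/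
abbrev T (m n : ℕ) := (Multiset (Fin m) × Multiset (Fin n)) →₀ ℂ

noncomputable def psi (m n : ℕ) : MvPolynomial (Fin m × Fin n) ℂ →ₗ[ℂ] T m n :=
  (basisMonomials (Fin m × Fin n) ℂ).constr ℂ fun d =>
    Finsupp.single ((Finsupp.toMultiset d).map Prod.fst, (Finsupp.toMultiset d).map Prod.snd) 1

lemma psi_mon (s : Multiset (Fin m × Fin n)) :
    psi m n (mon s) = Finsupp.single (s.map Prod.fst, s.map Prod.snd) 1 := by
  have := (basisMonomials (Fin m × Fin n) ℂ).constr_basis ℂ (fun d =>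
    (Finsupp.single ((Finsupp.toMultiset d).map Prod.fst, (Finsupp.toMultiset d).map Prod.snd) 1
      : T m n)) (Multiset.toFinsupp s)
  rw [coe_basisMonomials] at this
  beta_reduce at this
  rw [← mon_eq] at this
  rw [psi, this]
  simp

lemma psi_mul_minor (p : MvPolynomial (Fin m × Fin n) ℂ) (w : MinorIdx m n) :
    psi m n (p * minorΔ w) = 0 := by
  induction p using MvPolynomial.induction_on' with
  | monomial u a =>
    have h1 : monomial u a = a • mon (Finsupp.toMultiset u) := by
      rw [mon_eq, smul_monomial]; simp
    have h2 : minorΔ w = mon {(w.1.1.1, w.1.2.1), (w.1.1.2, w.1.2.2)} -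
      mon {(w.1.1.1, w.1.2.2), (w.1.1.2, w.1.2.1)} := by simp [mon, minorΔ]
    rw [h1, h2, smul_mul_assoc, map_smul, mul_sub, ← mon_add, ← mon_add, map_sub, psi_mon, psi_mon]
    have e : ∀ a b : Fin n, ({a, b} : Multiset (Fin n)) = {b, a} := Multiset.pair_comm
    simp only [Multiset.map_add, Multiset.insert_eq_cons, Multiset.map_cons, Multiset.map_singleton]
    simp only [← Multiset.insert_eq_cons]
    rw [e w.1.2.1, sub_self, smul_zero]
  | add p q hp hq => rw [add_mul, map_add, hp, hq, add_zero]

/-- The map `c ↦ ∑ c_w Δ_w`. -/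
noncomputable def phi (m n : ℕ) : (MinorIdx m n → MvPolynomial (Fin m × Fin n) ℂ) →ₗ[ℂ]
    MvPolynomial (Fin m × Fin n) ℂ where
  toFun c := ∑ w, c w * minorΔ w
  map_add' a b := by simp [add_mul, Finset.sum_add_distrib]
  map_smul' a b := by simp [Finset.smul_sum]

/-- families of quadrics -/
noncomputable def P (m n : ℕ) : Submodule ℂ (MinorIdx m n → MvPolynomial (Fin m × Fin n) ℂ) :=
  Submodule.pi Set.univ fun _ => homogeneousSubmodule (Fin m × Fin n) ℂ 2

lemma map_phi_P : (P m n).map (phi m n) =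
    homogeneousSubmodule (Fin m × Fin n) ℂ 4 ⊓ LinearMap.ker (psi m n) := by
  apply le_antisymm
  · rintro _ ⟨c, hc, rfl⟩
    have hc' : ∀ w, (c w).IsHomogeneous 2 := fun w => hc w trivial
    refine ⟨?_, ?_⟩
    · exact IsHomogeneous.sum _ _ _ fun w _ => (hc' w).mul (minor_hom w)
    · rw [SetLike.mem_coe, LinearMap.mem_ker]
      change psi m n (∑ w, c w * minorΔ w) = 0
      rw [map_sum]
      exact Finset.sum_eq_zero fun w _ => psi_mul_minor _ _
  · rintro x ⟨hx, hx0⟩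
    have hI : x ∈ I m n := by
      -- section
      classical
      let sec : Multiset (Fin m) × Multiset (Fin n) → MvPolynomial (Fin m × Fin n) ℂ := fun t =>
        if h : ∃ s : Multiset (Fin m × Fin n), (s.map Prod.fst, s.map Prod.snd) = t
        then mon h.choose else 0
      let θ : T m n →ₗ[ℂ] MvPolynomial (Fin m × Fin n) ℂ := Finsupp.linearCombination ℂ sec
      have hθ : ∀ y : MvPolynomial (Fin m × Fin n) ℂ, y - θ (psi m n y) ∈ I m n := by
        intro y
        induction y using MvPolynomial.induction_on' with
        | monomial u a =>
          have h1 : monomial u a = a • mon (Finsupp.toMultiset u) := by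
            rw [mon_eq, smul_monomial]; simp
          rw [h1, map_smul, map_smul, ← smul_sub, psi_mon]
          apply Submodule.smul_of_tower_mem
          have hex : ∃ s : Multiset (Fin m × Fin n), (s.map Prod.fst, s.map Prod.snd) =
            ((Finsupp.toMultiset u).map Prod.fst, (Finsupp.toMultiset u).map Prod.snd) := ⟨_, rfl⟩
          have : θ (Finsupp.single ((Finsupp.toMultiset u).map Prod.fst,
              (Finsupp.toMultiset u).map Prod.snd) 1) = mon hex.choose := by
            simp only [θ, Finsupp.linearCombination_single, one_smul, sec]
            rw [dif_pos hex]
          rw [this]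
          have hs := hex.choose_spec
          rw [Prod.mk.injEq] at hs
          exact mon_sub_mem _ _ hs.1.symm hs.2.symm
        | add p q hp hq =>
          rw [map_add, map_add]
          convert (I m n).add_mem hp hq using 1
          ring
      have := hθ x
      rw [SetLike.mem_coe, LinearMap.mem_ker] at hx0
      simpa [hx0] using this
    rw [I, Ideal.mem_span_range_iff_exists_fun] at hI
    obtain ⟨c, hc⟩ := hI
    refine ⟨fun w => homogeneousComponent 2 (c w), ?_, ?_⟩
    · intro w _
      exact homogeneousComponent_isHomogeneous 2 (c w)
    · change ∑ w, homogeneousComponent 2 (c w) * minorΔ w = x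
      have h4 := homogeneousComponent_of_mem (m := 4) hx
      rw [if_pos rfl] at h4
      rw [← h4, ← hc, map_sum]
      exact Finset.sum_congr rfl fun w _ => (homogComp_mul (k := 2) (d := 2) _ _ (minor_hom w)).symm

lemma exists_lift {α β : Type*} (k : ℕ) : ∀ (a : Multiset α) (b : Multiset β),
    Multiset.card a = k → Multiset.card b = k →
    ∃ s : Multiset (α × β), s.map Prod.fst = a ∧ s.map Prod.snd = b := by
  induction k with
  | zero =>
    intro a b ha hb
    rw [Multiset.card_eq_zero] at ha hb
    exact ⟨0, by simp [ha], by simp [hb]⟩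
  | succ k ih =>
    intro a b ha hb
    obtain ⟨x, hx⟩ := Multiset.card_pos_iff_exists_mem.1 (by omega : 0 < Multiset.card a)
    obtain ⟨a', rfl⟩ := Multiset.exists_cons_of_mem hx
    obtain ⟨y, hy⟩ := Multiset.card_pos_iff_exists_mem.1 (by omega : 0 < Multiset.card b)
    obtain ⟨b', rfl⟩ := Multiset.exists_cons_of_mem hy
    obtain ⟨s, h1, h2⟩ := ih a' b' (by simpa using ha) (by simpa using hb)
    exact ⟨(x, y) ::ₘ s, by simp [h1], by simp [h2]⟩

lemma finrank_map_psi : Module.finrank ℂ ((homogeneousSubmodule (Fin m × Fin n) ℂ 4).map (psi m n))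
    = (m + 4 - 1).choose 4 * (n + 4 - 1).choose 4 := by
  have h : (homogeneousSubmodule (Fin m × Fin n) ℂ 4).map (psi m n) =
      Submodule.span ℂ (Set.range fun p : Sym (Fin m) 4 × Sym (Fin n) 4 =>
        (Finsupp.single ((p.1 : Multiset (Fin m)), (p.2 : Multiset (Fin n))) 1 : T m n)) := by
    rw [hom_eq_span, Submodule.map_span, ← Set.range_comp]
    congr 1
    ext y
    constructor
    · rintro ⟨s, rfl⟩
      refine ⟨(⟨s.1.map Prod.fst, by simp [s.2]⟩, ⟨s.1.map Prod.snd, by simp [s.2]⟩), ?_⟩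
      simp only [Function.comp, psi_mon]
      rfl
    · rintro ⟨⟨a, b⟩, rfl⟩
      obtain ⟨s, h1, h2⟩ := exists_lift 4 a.1 b.1 a.2 b.2
      refine ⟨⟨s, by rw [← a.2, ← h1, Multiset.card_map]⟩, ?_⟩
      simp only [Function.comp, psi_mon]
      simp only [Sym.coe_mk, h1, h2]
      rfl
  have li : LinearIndependent ℂ (fun p : Sym (Fin m) 4 × Sym (Fin n) 4 =>
        (Finsupp.single ((p.1 : Multiset (Fin m)), (p.2 : Multiset (Fin n))) 1 : T m n)) := by
    have h0 := (Finsupp.basisSingleOne (R := ℂ)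
      (ι := Multiset (Fin m) × Multiset (Fin n))).linearIndependent
    have h1 := h0.comp (fun p : Sym (Fin m) 4 × Sym (Fin n) 4 =>
      ((p.1 : Multiset (Fin m)), (p.2 : Multiset (Fin n)))) (by
        rintro ⟨a, b⟩ ⟨c, d⟩ h
        rw [Prod.mk.injEq] at h
        exact Prod.ext (Subtype.ext h.1) (Subtype.ext h.2))
    convert h1 using 1
    funext p
    simp
  rw [h, finrank_span_eq_card li, Fintype.card_prod, Sym.card_sym_eq_choose, Sym.card_sym_eq_choose]
  simp

instance (k : ℕ) : FiniteDimensional ℂ (homogeneousSubmodule (Fin m × Fin n) ℂ k) := by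
  rw [hom_eq_span]
  exact FiniteDimensional.span_of_finite ℂ (Set.finite_range _)

noncomputable def PEquiv (m n : ℕ) :
    P m n ≃ₗ[ℂ] (MinorIdx m n → homogeneousSubmodule (Fin m × Fin n) ℂ 2) where
  toFun c w := ⟨c.1 w, c.2 w trivial⟩
  invFun c := ⟨fun w => (c w).1, fun w _ => (c w).2⟩
  map_add' _ _ := rfl
  map_smul' _ _ := rfl
  left_inv _ := rfl
  right_inv _ := rfl

instance : FiniteDimensional ℂ (P m n) :=
  Module.Finite.equiv (PEquiv m n).symm

lemma finrank_P : Module.finrank ℂ (P m n) =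
    m.choose 2 * n.choose 2 * (m * n + 2 - 1).choose 2 := by
  rw [(PEquiv m n).finrank_eq, Module.finrank_pi_fintype]
  simp [finrank_hom, card_minorIdx]

lemma syz_eq : Syz m n 4 = P m n ⊓ LinearMap.ker (phi m n) := by
  ext c
  constructor
  · rintro ⟨h1, h2⟩
    exact ⟨fun w _ => h1 w, h2⟩
  · rintro ⟨h1, h2⟩
    exact ⟨fun w => h1 w trivial, h2⟩

/-- rank-nullity for the restriction to a submodule. -/
lemma rank_nullity {V W : Type*} [AddCommGroup V] [Module ℂ V] [AddCommGroup W] [Module ℂ W]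
    (f : V →ₗ[ℂ] W) (p : Submodule ℂ V) [FiniteDimensional ℂ p] :
    Module.finrank ℂ (p.map f) + Module.finrank ℂ ↥(p ⊓ LinearMap.ker f) = Module.finrank ℂ p := by
  have h := (f.domRestrict p).finrank_range_add_finrank_ker
  rw [LinearMap.range_domRestrict] at h
  rw [← h]
  congr 1
  have : LinearMap.ker (f.domRestrict p) = (p ⊓ LinearMap.ker f).comap p.subtype := by
    ext x; simp [LinearMap.mem_ker]
  rw [this]
  exact (Submodule.comapSubtypeEquivOfLe inf_le_left).symm.finrank_eq

lemma finrank_syz : Module.finrank ℂ (Syz m n 4) + (m * n + 4 - 1).choose 4 =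
    m.choose 2 * n.choose 2 * (m * n + 2 - 1).choose 2 +
      (m + 4 - 1).choose 4 * (n + 4 - 1).choose 4 := by
  have h1 := rank_nullity (phi m n) (P m n)
  have h2 := rank_nullity (psi m n) (homogeneousSubmodule (Fin m × Fin n) ℂ 4)
  rw [← syz_eq, map_phi_P, finrank_P] at h1
  rw [finrank_map_psi, finrank_hom, Fintype.card_prod, Fintype.card_fin, Fintype.card_fin] at h2
  omega

/-- Koszul syzygy -/
noncomputable def kos (w w' : MinorIdx m n) : MinorIdx m n → MvPolynomial (Fin m × Fin n) ℂ :=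
  Pi.single w (minorΔ w') - Pi.single w' (minorΔ w)

lemma kos_mem_syz (w w' : MinorIdx m n) : kos w w' ∈ Syz m n 4 := by
  refine ⟨fun v => ?_, ?_⟩
  · apply Submodule.sub_mem
    · by_cases h : v = w
      · subst h; rw [Pi.single_eq_same]; exact minor_hom _
      · rw [Pi.single_eq_of_ne h]; exact Submodule.zero_mem _
    · by_cases h : v = w'
      · subst h; rw [Pi.single_eq_same]; exact minor_hom _
      · rw [Pi.single_eq_of_ne h]; exact Submodule.zero_mem _
  · simp only [kos, Pi.sub_apply, sub_mul, Finset.sum_sub_distrib]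
    simp [Pi.single_apply, ite_mul, mul_comm]

lemma kos_eq_span : Kos m n 4 =
    Submodule.span ℂ (Set.range fun p : MinorIdx m n × MinorIdx m n => kos p.1 p.2) := by
  apply le_antisymm
  · rintro x ⟨hx, hk⟩
    have key : ∀ y ∈ KosMod m n, (fun w => homogeneousComponent 2 (y w)) ∈
      Submodule.span ℂ (Set.range fun p : MinorIdx m n × MinorIdx m n => kos p.1 p.2) := by
      intro y hy
      induction hy using Submodule.closure_induction with
      | zero =>
        have : (fun w : MinorIdx m n => homogeneousComponent 2
            ((0 : MinorIdx m n → MvPolynomial (Fin m × Fin n) ℂ) w)) = 0 := by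
          funext w; simp
        rw [this]
        exact Submodule.zero_mem _
      | add x y _ _ hx hy =>
        convert Submodule.add_mem _ hx hy using 1
        funext w; simp
      | smul_mem r y hy =>
        obtain ⟨w, w', rfl⟩ := hy
        have : (fun v => homogeneousComponent 2
            ((r • (Pi.single w (minorΔ w') - Pi.single w' (minorΔ w)) : MinorIdx m n → _) v)) =
            coeff 0 r • kos w w' := by
          funext v
          have hv : IsHomogeneous (kos w w' v) 2 := (kos_mem_syz w w').1 v
          have := homogComp_mul (k := 0) r _ hv
          rw [zero_add, homogeneousComponent_zero, ← smul_eq_C_mul] at this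
          exact this
        rw [this]
        exact Submodule.smul_mem _ _ (Submodule.subset_span ⟨(w, w'), rfl⟩)
    have h := key x hk
    convert h using 1
    funext w
    have := homogeneousComponent_of_mem (m := 2) (hx.1 w)
    rw [this, if_pos rfl]
  · rw [Submodule.span_le]
    rintro _ ⟨⟨w, w'⟩, rfl⟩
    exact ⟨kos_mem_syz w w', Submodule.subset_span ⟨w, w', rfl⟩⟩

lemma finrank_kos : Module.finrank ℂ (Kos m n 4) = (m.choose 2 * n.choose 2).choose 2 := by
  letI : LinearOrder (MinorIdx m n) :=
    LinearOrder.lift' (Fintype.equivFin (MinorIdx m n)) (Fintype.equivFin _).injective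
  have hspan : Kos m n 4 = Submodule.span ℂ (Set.range
      fun p : {p : MinorIdx m n × MinorIdx m n // p.1 < p.2} => kos p.1.1 p.1.2) := by
    rw [kos_eq_span]
    apply le_antisymm
    · rw [Submodule.span_le]
      rintro _ ⟨⟨w, w'⟩, rfl⟩
      rcases lt_trichotomy w w' with h | rfl | h
      · exact Submodule.subset_span ⟨⟨(w, w'), h⟩, rfl⟩
      · simp [kos]
      · have : kos w w' = - kos w' w := by simp [kos]
        simp only [this]
        exact Submodule.neg_mem _ (Submodule.subset_span ⟨⟨(w', w), h⟩, rfl⟩)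
    · apply Submodule.span_mono
      rintro _ ⟨p, rfl⟩
      exact ⟨p.1, rfl⟩
  have li : LinearIndependent ℂ
      (fun p : {p : MinorIdx m n × MinorIdx m n // p.1 < p.2} => kos p.1.1 p.1.2) := by
    rw [Fintype.linearIndependent_iff]
    rintro g hg ⟨⟨a, b⟩, hab⟩
    simp only at hab
    have h1 := congrArg (coeff (Finsupp.single (b.1.1.1, b.1.2.1) 1 +
      Finsupp.single (b.1.1.2, b.1.2.2) 1)) (congrFun hg a)
    rw [Finset.sum_apply, coeff_sum] at h1
    rw [Finset.sum_eq_single ⟨(a, b), hab⟩] at h1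
    · simpa [kos, Pi.single_apply, hab.ne, coeff_minor] using h1
    · rintro ⟨⟨c, d⟩, hcd⟩ _ hne
      simp only at hcd
      have hne' : ¬ (a = c ∧ d = b) := by
        rintro ⟨rfl, rfl⟩; exact hne rfl
      have hne2 : ¬ (a = d ∧ c = b) := by
        rintro ⟨rfl, rfl⟩; exact lt_asymm hab hcd
      simp only [kos, Pi.smul_apply, Pi.sub_apply, Pi.single_apply, coeff_smul, coeff_sub]
      have e1 : coeff (Finsupp.single (b.1.1.1, b.1.2.1) 1 +
        Finsupp.single (b.1.1.2, b.1.2.2) 1) (if a = c then minorΔ d else 0) = 0 := by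
        split_ifs with h
        · rw [coeff_minor, if_neg fun h' => hne' ⟨h, h'⟩]
        · simp
      have e2 : coeff (Finsupp.single (b.1.1.1, b.1.2.1) 1 +
        Finsupp.single (b.1.1.2, b.1.2.2) 1) (if a = d then minorΔ c else 0) = 0 := by
        split_ifs with h
        · rw [coeff_minor, if_neg fun h' => hne2 ⟨h, h'⟩]
        · simp
      rw [e1, e2]; simp
    · intro h; exact absurd (Finset.mem_univ _) h
  rw [hspan, finrank_span_eq_card li, card_lt, card_minorIdx]

lemma ch2 (k : ℕ) : ((k.choose 2 : ℕ) : ℚ) = k * (k - 1) / 2 := Nat.cast_choose_two ℚ k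

lemma ch4 (k : ℕ) : ((k.choose 4 : ℕ) : ℚ) = k * (k - 1) * (k - 2) * (k - 3) / 24 := by
  rw [Nat.cast_choose_eq_descPochhammer_div]
  simp [descPochhammer_succ_right, Nat.factorial]

lemma div8a (m : ℕ) (hm : 1 ≤ m) : ((m * (m + 1) * (m - 1) * (m - 2) / 8 : ℕ) : ℚ) =
    m * (m + 1) * (m - 1) * (m - 2) / 8 := by
  have h : m * (m + 1) * (m - 1) * (m - 2) / 8 = 3 * (m + 1).choose 4 := by
    have := Nat.descFactorial_eq_factorial_mul_choose (m + 1) 4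
    simp only [Nat.descFactorial, Nat.factorial] at this
    have e : m * (m + 1) * (m - 1) * (m - 2) = 8 * (3 * (m + 1).choose 4) := by
      rw [show m + 1 - 3 = m - 2 by omega, show m + 1 - 2 = m - 1 by omega] at this
      simp at this
      nlinarith
    rw [e]; simp
  rw [h]; push_cast [ch4]; ring

lemma div8b (m : ℕ) (hm : 1 ≤ m) : ((m * (m + 1) * (m + 2) * (m - 1) / 8 : ℕ) : ℚ) =
    m * (m + 1) * (m + 2) * (m - 1) / 8 := by
  have h : m * (m + 1) * (m + 2) * (m - 1) / 8 = 3 * (m + 2).choose 4 := by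
    have := Nat.descFactorial_eq_factorial_mul_choose (m + 2) 4
    simp only [Nat.descFactorial, Nat.factorial] at this
    have e : m * (m + 1) * (m + 2) * (m - 1) = 8 * (3 * (m + 2).choose 4) := by
      rw [show m + 2 - 3 = m - 1 by omega, show m + 2 - 2 = m by omega] at this
      simp at this
      nlinarith
    rw [e]; simp
  rw [h]; push_cast [ch4]; ring

lemma div12 (m : ℕ) (hm : 1 ≤ m) : ((m ^ 2 * (m ^ 2 - 1) / 12 : ℕ) : ℚ) =
    m ^ 2 * (m ^ 2 - 1) / 12 := by
  have h1 : ((m ^ 2 - 1 : ℕ) : ℚ) = m ^ 2 - 1 := by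
    rw [Nat.cast_sub (Nat.one_le_pow _ _ hm)]; simp
  have e : m ^ 2 * (m ^ 2 - 1) = 12 * ((m + 1).choose 4 + (m + 2).choose 4) := by
    have : ((m ^ 2 * (m ^ 2 - 1) : ℕ) : ℚ) = ((12 * ((m + 1).choose 4 + (m + 2).choose 4) : ℕ) : ℚ) := by
      rw [Nat.cast_mul, h1]
      push_cast [ch4]
      ring
    exact_mod_cast this
  rw [e, Nat.mul_div_cancel_left _ (by norm_num)]
  push_cast [ch4]
  ring

end KH


/-- The degree-4 part of the first Koszul homology of the 2×2 minors,
`Syz₄ / Kos₄`, has the stated dimension. -/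
theorem dim_koszul_homology_minors_degree_four (m n : ℕ) (hm : 1 ≤ m) (hn : 1 ≤ n) :
    Module.finrank ℂ
      (↥(Syz m n 4) ⧸ Submodule.comap (Syz m n 4).subtype (Kos m n 4)) =
      m ^ 2 * (m ^ 2 - 1) / 12 * Nat.choose n 4 +
        Nat.choose m 4 * (n ^ 2 * (n ^ 2 - 1) / 12) +
        m * (m + 1) * (m - 1) * (m - 2) / 8 * (n * (n + 1) * (n - 1) * (n - 2) / 8) +
        m * (m + 1) * (m - 1) * (m - 2) / 8 * (n * (n + 1) * (n + 2) * (n - 1) / 8) +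
        m * (m + 1) * (m + 2) * (m - 1) / 8 * (n * (n + 1) * (n - 1) * (n - 2) / 8) := by
  have : FiniteDimensional ℂ (Syz m n 4) := by
    rw [KH.syz_eq]
    exact Submodule.finiteDimensional_inf_left _ _
  have h1 := Submodule.finrank_quotient_add_finrank
    (Submodule.comap (Syz m n 4).subtype (Kos m n 4))
  have h2 : Module.finrank ℂ (Submodule.comap (Syz m n 4).subtype (Kos m n 4)) =
      Module.finrank ℂ (Kos m n 4) :=
    (Submodule.comapSubtypeEquivOfLe inf_le_left).finrank_eq
  rw [h2, KH.finrank_kos] at h1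
  have h3 := KH.finrank_syz (m := m) (n := n)
  rw [← h1] at h3
  rw [show m * n + 4 - 1 = m * n + 3 by omega, show m * n + 2 - 1 = m * n + 1 by omega,
    show m + 4 - 1 = m + 3 by omega, show n + 4 - 1 = n + 3 by omega] at h3
  have h4 := congrArg (Nat.cast : ℕ → ℚ) h3
  push_cast [KH.ch2, KH.ch4] at h4
  rw [← Nat.cast_inj (R := ℚ)]
  simp only [Nat.cast_add, Nat.cast_mul (_ / _), Nat.cast_mul (Nat.choose m 4), KH.div8a m hm,
    KH.div8a n hn, KH.div8b m hm, KH.div8b n hn, KH.div12 m hm, KH.div12 n hn, KH.ch4]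
  linear_combination h4
end
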